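/- Let q be a prime power, m ≥ 1, and E a finite field with q^m elements. The number of bijections f : E → E that are induced by a polynomial with coefficients in F_q (equivalently, permutation polynomials of E with coefficients in F_q) equals ∏_{k | m} k^{π(k)} · π(k)!, where π(k) is the number of monic irreducible polynomials of degree k over F_q. -/

import Mathlib

open Polynomial Equiv.Perm FiniteField

theorem exists_minpoly_eq_of_natDegree_dvd_finrank {F E : Type*} [Field F] [Field E]
    [Finite E] [Algebra F E] {P : F[X]} (hP : P.Monic)
    (hi : Irreducible P) (hd : P.natDegree ∣ Module.finrank F E) : ∃ x : E, minpoly F x = P := by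
  have : Fact (Irreducible P) := ⟨hi⟩
  have hfin : Module.finrank F (AdjoinRoot P) = P.natDegree := finrank_quotient_span_eq_natDegree
  have : FiniteDimensional F (AdjoinRoot P) := (AdjoinRoot.powerBasis hi.ne_zero).finite
  obtain ⟨φ⟩ := nonempty_algHom_of_finrank_dvd (F := F) (K := AdjoinRoot P) (L := E) (hfin ▸ hd)
  refine ⟨φ (AdjoinRoot.root P), (minpoly.eq_of_irreducible_of_monic hi ?_ hP).symm⟩
  rw [aeval_algHom_apply, AdjoinRoot.aeval_eq, AdjoinRoot.mk_self, map_zero]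

section FrobeniusPermutation

variable (F E : Type*) [Field F] [Fintype F] [Field E] [Fintype E] [Algebra F E]

/-- The permutation `x ↦ x ^ #F` of a finite extension `E` of the finite field `F`. -/
noncomputable def frobeniusPerm : Equiv.Perm E :=
  (frobeniusAlgEquivOfAlgebraic F E).toEquiv

variable {E} in
theorem frobeniusPerm_apply (x : E) :
    frobeniusPerm F E x = frobeniusAlgEquivOfAlgebraic F E x := rfl

variable {E} in
theorem frobeniusPerm_pow_apply (n : ℕ) (x : E) :
    (frobeniusPerm F E ^ n) x = (frobeniusAlgEquivOfAlgebraic F E ^ n) x := by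
  induction n generalizing x with
  | zero => rfl
  | succ n ih => rw [pow_succ, pow_succ, mul_apply, ih, AlgEquiv.mul_apply, frobeniusPerm_apply]

theorem frobeniusPerm_pow_finrank : frobeniusPerm F E ^ Module.finrank F E = 1 := by
  ext x
  rw [frobeniusPerm_pow_apply, ← orderOf_frobeniusAlgEquivOfAlgebraic, pow_orderOf_eq_one]
  rfl

variable {E}

theorem exists_frobeniusPerm_pow (g : Gal(E/F)) : ∃ n : ℕ, ∀ x, (frobeniusPerm F E ^ n) x = g x := by
  obtain ⟨n, hn⟩ := (bijective_frobeniusAlgEquivOfAlgebraic_pow F E).2 g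
  exact ⟨n, fun x ↦ by rw [frobeniusPerm_pow_apply, ← hn]⟩

theorem sameCycle_frobeniusPerm_iff (x y : E) :
    (frobeniusPerm F E).SameCycle x y ↔ minpoly F y = minpoly F x := by
  rw [← isConjRoot_def, isConjRoot_iff_exists_algEquiv]
  constructor
  · intro h
    obtain ⟨n, -, hn⟩ := h.exists_pow_eq'
    exact ⟨frobeniusAlgEquivOfAlgebraic F E ^ n, by rw [← hn, frobeniusPerm_pow_apply]⟩
  · rintro ⟨g, rfl⟩
    obtain ⟨n, hn⟩ := exists_frobeniusPerm_pow F g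
    exact ⟨n, by simpa using hn x⟩

theorem mem_range_algebraMap_iff_frobeniusPerm (x : E) :
    x ∈ Set.range (algebraMap F E) ↔ frobeniusPerm F E x = x := by
  rw [IsGalois.mem_range_algebraMap_iff_fixed]
  refine ⟨fun h ↦ h _, fun h g ↦ ?_⟩
  obtain ⟨n, hn⟩ := exists_frobeniusPerm_pow F g
  rw [← hn, pow_apply_eq_self_of_apply_eq_self h]

theorem natDegree_minpoly_eq_one_iff_frobeniusPerm (x : E) :
    (minpoly F x).natDegree = 1 ↔ frobeniusPerm F E x = x := by
  rw [minpoly.natDegree_eq_one_iff, ← mem_range_algebraMap_iff_frobeniusPerm]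
  rfl

theorem card_support_cycleOf_frobeniusPerm [DecidableEq E] {x : E}
    (hx : frobeniusPerm F E x ≠ x) :
    ((frobeniusPerm F E).cycleOf x).support.card = (minpoly F x).natDegree := by
  rw [← card_rootSet_eq_natDegree (Algebra.IsSeparable.isSeparable F x)
    (Normal.splits inferInstance x), ← Fintype.card_coe]
  refine Fintype.card_congr (Equiv.subtypeEquivRight fun y ↦ ?_)
  rw [mem_support_cycleOf_iff' hx, sameCycle_frobeniusPerm_iff,
    ← isConjRoot_iff_mem_minpoly_rootSet (Algebra.IsIntegral.isIntegral x), isConjRoot_def,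
    eq_comm]

variable (E)

theorem card_fixedPoints_frobeniusPerm :
    Nat.card (Function.fixedPoints (frobeniusPerm F E)) =
      Nat.card {P : F[X] // P.Monic ∧ Irreducible P ∧ P.natDegree = 1} := by
  refine Nat.card_eq_of_bijective
    (fun x ↦ ⟨minpoly F x.1, minpoly.monic (Algebra.IsIntegral.isIntegral _),
      minpoly.irreducible (Algebra.IsIntegral.isIntegral _),
      (natDegree_minpoly_eq_one_iff_frobeniusPerm F x.1).2 x.2⟩) ⟨?_, ?_⟩
  · rintro ⟨x, hx⟩ ⟨y, hy⟩ h
    have hxy := (sameCycle_frobeniusPerm_iff F y x).2 (congrArg Subtype.val h)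
    exact Subtype.ext (hxy.eq_of_left hy).symm
  · rintro ⟨P, hP, hi, hd⟩
    obtain ⟨x, rfl⟩ := exists_minpoly_eq_of_natDegree_dvd_finrank (E := E) hP hi (by simp [hd])
    exact ⟨⟨x, (natDegree_minpoly_eq_one_iff_frobeniusPerm F x).1 hd⟩, rfl⟩

theorem count_cycleType_frobeniusPerm [DecidableEq E] {k : ℕ} (hk : k ∣ Module.finrank F E)
    (hk1 : k ≠ 1) :
    (frobeniusPerm F E).cycleType.count k =
      Nat.card {P : F[X] // P.Monic ∧ Irreducible P ∧ P.natDegree = k} := by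
  rw [CycleType.count_def, ← Nat.card_eq_fintype_card]
  have hroot (P : {P : F[X] // P.Monic ∧ Irreducible P ∧ P.natDegree = k}) :
      ∃ x : E, minpoly F x = P.1 :=
    exists_minpoly_eq_of_natDegree_dvd_finrank P.2.1 P.2.2.1 (P.2.2.2.symm ▸ hk)
  choose r hr using hroot
  have hfix (P) : frobeniusPerm F E (r P) ≠ r P := by
    rw [Ne, ← natDegree_minpoly_eq_one_iff_frobeniusPerm, hr, P.2.2.2]
    exact hk1
  symm
  refine Nat.card_eq_of_bijective
    (fun P ↦ ⟨⟨(frobeniusPerm F E).cycleOf (r P),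
      cycleOf_mem_cycleFactorsFinset_iff.2 (mem_support.2 (hfix P))⟩,
      by rw [card_support_cycleOf_frobeniusPerm F (hfix P), hr, P.2.2.2]⟩) ⟨?_, ?_⟩
  · intro P Q h
    have h' : (frobeniusPerm F E).cycleOf (r P) = (frobeniusPerm F E).cycleOf (r Q) :=
      congrArg (fun c ↦ c.1.1) h
    rw [← sameCycle_iff_cycleOf_eq_of_mem_support (mem_support.2 (hfix P))
      (mem_support.2 (hfix Q)), sameCycle_frobeniusPerm_iff, hr, hr] at h'
    exact Subtype.ext h'.symm
  · rintro ⟨⟨c, hc⟩, hck⟩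
    obtain ⟨x, hx⟩ := (mem_cycleFactorsFinset_iff.1 hc).1.nonempty_support
    have hcx := cycle_is_cycleOf hx hc
    have hxs : frobeniusPerm F E x ≠ x :=
      mem_support.1 (mem_cycleFactorsFinset_support_le hc hx)
    let P : {P : F[X] // P.Monic ∧ Irreducible P ∧ P.natDegree = k} :=
      ⟨minpoly F x, minpoly.monic (Algebra.IsIntegral.isIntegral _),
        minpoly.irreducible (Algebra.IsIntegral.isIntegral _), by
          rw [← card_support_cycleOf_frobeniusPerm F hxs, ← hcx]; exact hck⟩
    refine ⟨P, Subtype.ext (Subtype.ext ?_)⟩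
    exact (((sameCycle_frobeniusPerm_iff F (r P) x).2 (hr P).symm).cycleOf_eq).trans hcx.symm

variable {E}

theorem exists_aeval_eq_iff_comm_frobeniusPerm (f : E → E) :
    (∃ g : F[X], ∀ x, f x = aeval x g) ↔
      ∀ x, f (frobeniusPerm F E x) = frobeniusPerm F E (f x) := by
  classical
  constructor
  · rintro ⟨g, hg⟩ x
    rw [hg, hg, frobeniusPerm_apply, frobeniusPerm_apply, aeval_algHom_apply]
  · intro h
    let σ := frobeniusAlgEquivOfAlgebraic F E
    have hinj : Set.InjOn (id : E → E) (Finset.univ : Finset E) := Set.injOn_id _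
    let p := Lagrange.interpolate Finset.univ id f
    have heval (x : E) : p.eval x = f x :=
      Lagrange.eval_interpolate_at_node f hinj (Finset.mem_univ x)
    have hmap : p.map (σ : E →+* E) = p := by
      refine Lagrange.eq_interpolate_of_eval_eq f hinj
        (degree_map_le.trans_lt (Lagrange.degree_interpolate_lt f hinj)) fun x _ ↦ ?_
      obtain ⟨y, rfl⟩ := (frobeniusPerm F E).surjective x
      rw [id, h, ← heval, frobeniusPerm_apply, frobeniusPerm_apply, eval_map]
      exact eval₂_hom (σ : E →+* E) y
    obtain ⟨g, hg⟩ := (mem_lifts _).1 ((lifts_iff_coeff_lifts (f := algebraMap F E) p).2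
      fun n ↦ (mem_range_algebraMap_iff_frobeniusPerm F _).2
        (by conv_rhs => rw [← hmap, coeff_map]
            rfl))
    exact ⟨g, fun x ↦ by rw [← heval, ← hg, eval_map_algebraMap]⟩

variable (E)

theorem card_bijective_induced_eq_card_centralizer :
    Nat.card {f : E → E // Function.Bijective f ∧ ∃ g : F[X], ∀ x, f x = aeval x g} =
      Nat.card (Subgroup.centralizer {frobeniusPerm F E}) := by
  refine Nat.card_eq_of_bijective
    (fun f ↦ ⟨Equiv.ofBijective f.1 f.2.1, Subgroup.mem_centralizer_singleton_iff.2 <|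
      Equiv.ext ((exists_aeval_eq_iff_comm_frobeniusPerm F f.1).1 f.2.2)⟩) ⟨?_, ?_⟩
  · intro f g h
    exact Subtype.ext (congrArg (fun τ ↦ (τ.1 : E → E)) h)
  · rintro ⟨τ, hτ⟩
    refine ⟨⟨τ, τ.bijective, (exists_aeval_eq_iff_comm_frobeniusPerm F τ).2 fun x ↦ ?_⟩,
      Subtype.ext (Equiv.ext fun x ↦ rfl)⟩
    exact Equiv.congr_fun (Subgroup.mem_centralizer_singleton_iff.1 hτ) x

end FrobeniusPermutation

/-- The number of bijections `f : E → E` of a finite field with `q ^ m` elements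
that are induced by a polynomial with coefficients in `F_q` (permutation polynomials with
coefficients in `F_q`) equals `∏_{k ∣ m} k ^ π(k) · π(k)!`. -/
theorem stmt_9 (q m : ℕ) (hq : IsPrimePow q) (hm : 1 ≤ m)
    (F E : Type*) [Field F] [Fintype F] [Field E] [Fintype E] [Algebra F E]
    (hF : Fintype.card F = q) (hE : Fintype.card E = q ^ m)
    (π : ℕ → ℕ)
    (hπ : ∀ k, π k = Nat.card {P : Polynomial F // P.Monic ∧ Irreducible P ∧ P.natDegree = k}) :
    Nat.card {f : E → E //
        Function.Bijective f ∧ ∃ g : Polynomial F, ∀ x, f x = Polynomial.aeval x g} =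
      ∏ k ∈ m.divisors, k ^ π k * (π k).factorial := by
  classical
  have hfr : Module.finrank F E = m := by
    refine Nat.pow_right_injective hq.two_le ?_
    simpa [hF, hE] using (Module.card_eq_pow_finrank (K := F) (V := E)).symm
  let σ := frobeniusPerm F E
  have hsub : σ.cycleType.toFinset ⊆ m.divisors.erase 1 := by
    intro k hk
    rw [Multiset.mem_toFinset] at hk
    rw [Finset.mem_erase, Nat.mem_divisors]
    refine ⟨(one_lt_of_mem_cycleType hk).ne', ?_, by omega⟩
    exact (dvd_of_mem_cycleType hk).trans
      (orderOf_dvd_of_pow_eq_one (hfr ▸ frobeniusPerm_pow_finrank F E))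
  have hcount (k : ℕ) (hk : k ∈ m.divisors.erase 1) : σ.cycleType.count k = π k := by
    rw [Finset.mem_erase, Nat.mem_divisors] at hk
    rw [hπ, ← count_cycleType_frobeniusPerm F E (hfr.symm ▸ hk.2.1) hk.1]
  have hfixed : Fintype.card E - σ.cycleType.sum = π 1 := by
    rw [← card_fixedPoints, hπ, ← card_fixedPoints_frobeniusPerm F E, Nat.card_eq_fintype_card]
  rw [card_bijective_induced_eq_card_centralizer, nat_card_centralizer, hfixed,
    Finset.prod_multiset_count_of_subset _ _ hsub,
    Finset.prod_subset hsub fun k _ hk ↦ by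
      rw [Multiset.count_eq_zero_of_notMem (by simpa using hk), Nat.factorial_zero],
    mul_assoc, ← Finset.prod_mul_distrib,
    ← Finset.mul_prod_erase _ _ (Nat.one_mem_divisors.2 (by omega : m ≠ 0)), one_pow, one_mul]
  exact congrArg _ (Finset.prod_congr rfl fun k hk ↦ by rw [hcount k hk])
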